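/- Let {S_j} be a scale sequence and let b_j(u) = √(a_{j+1}(u) − a_j(u)) be defined by the explicit construction: φ(t) = exp(−1/(1−t²)) for t ∈ (−1,1) and φ(t) = 0 otherwise; C_Φ = ∫_{−1}^{1} φ(t) dt; Φ(u) = 0 for u ≤ −1, Φ(u) = (1/C_Φ)∫_{−1}^{u} φ(t) dt for u ∈ (−1,1), Φ(u) = 1 for u ≥ 1; τ_j(u) = (S_j + S_{j−1} − 2u)/(S_j − S_{j−1}); a_j(u) = 1 for u ∈ [0, S_{j−1}], a_j(u) = Φ(τ_j(u)) for u ∈ (S_{j−1}, S_j], a_j(u) = 0 for u > S_j. Then for every n ≥ 1 there exists a constant K(n) > 0, independent of j, such that for all j ≥ 1 and all u > 0, |b_j^{(n)}(u)| ≤ K(n)/(S_j − S_{j−1})^n. -/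

import Mathlib

noncomputable section

/-- `φ(t) = exp(−1/(1−t²))` for `t ∈ (−1,1)`, `0` otherwise. -/
def phiFun (t : ℝ) : ℝ :=
  if -1 < t ∧ t < 1 then Real.exp (-1 / (1 - t ^ 2)) else 0

/-- `C_Φ = ∫_{−1}^{1} φ(t) dt`. -/
def CPhi : ℝ := ∫ t in (-1 : ℝ)..1, phiFun t

/-- `Φ(u) = 0` for `u ≤ −1`, `(1/C_Φ)∫_{−1}^{u} φ` for `u ∈ (−1,1)`, `1` for `u ≥ 1`. -/
def PhiFun (u : ℝ) : ℝ :=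
  if u ≤ -1 then 0
  else if u < 1 then (∫ t in (-1 : ℝ)..u, phiFun t) / CPhi
  else 1

/-- The linear change of variable `τ_j(u) = (S_j + S_{j−1} − 2u)/(S_j − S_{j−1})`. -/
def tauFun (S : ℕ → ℝ) (j : ℕ) (u : ℝ) : ℝ :=
  (S j + S (j - 1) - 2 * u) / (S j - S (j - 1))

/-- `a_j(u) = 1` on `[0, S_{j−1}]`, `Φ(τ_j(u))` on `(S_{j−1}, S_j]`, `0` for `u > S_j`. -/
def aFun (S : ℕ → ℝ) (j : ℕ) (u : ℝ) : ℝ :=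
  if u ≤ S (j - 1) then 1
  else if u ≤ S j then PhiFun (tauFun S j u)
  else 0

/-- The window function `b_j(u) = √(a_{j+1}(u) − a_j(u))`. -/
def bFun (S : ℕ → ℝ) (j : ℕ) (u : ℝ) : ℝ :=
  Real.sqrt (aFun S (j + 1) u - aFun S j u)

/-- The unnormalised primitive of `phiFun`. -/
def FInt (u : ℝ) : ℝ := ∫ t in (-1 : ℝ)..u, phiFun t

lemma phiFun_eq_glue : phiFun = fun t => expNegInvGlue (1 - t ^ 2) := by
  funext t
  unfold phiFun expNegInvGlue
  by_cases h : -1 < t ∧ t < 1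
  · have h1 : ¬ (1 - t ^ 2 ≤ 0) := by nlinarith [h.1, h.2]
    rw [if_pos h, if_neg h1]
    congr 1
    rw [neg_div, one_div]
  · have h1 : 1 - t ^ 2 ≤ 0 := by
      by_contra hc
      apply h
      constructor <;> nlinarith
    rw [if_neg h, if_pos h1]

lemma phiFun_contDiff (n : ℕ) : ContDiff ℝ n phiFun := by
  rw [phiFun_eq_glue]
  exact (expNegInvGlue.contDiff (n := n)).comp (contDiff_const.sub (contDiff_id.pow 2))

lemma phiFun_cont : Continuous phiFun := (phiFun_contDiff 0).continuous

lemma phiFun_nonneg (t : ℝ) : 0 ≤ phiFun t := by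
  rw [phiFun_eq_glue]; exact expNegInvGlue.nonneg _

lemma phiFun_pos {t : ℝ} (h1 : -1 < t) (h2 : t < 1) : 0 < phiFun t := by
  unfold phiFun; rw [if_pos ⟨h1, h2⟩]; positivity

lemma phiFun_zero {t : ℝ} (h : t ≤ -1 ∨ 1 ≤ t) : phiFun t = 0 := by
  unfold phiFun; rw [if_neg]; rintro ⟨h1, h2⟩; rcases h with h | h <;> linarith

lemma phiFun_neg (t : ℝ) : phiFun (-t) = phiFun t := by
  rw [phiFun_eq_glue]; simp

lemma FInt_hasDerivAt (u : ℝ) : HasDerivAt FInt (phiFun u) u :=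
  intervalIntegral.integral_hasDerivAt_right (phiFun_cont.intervalIntegrable _ _)
    (phiFun_cont.stronglyMeasurableAtFilter _ _) phiFun_cont.continuousAt

lemma FInt_deriv : deriv FInt = phiFun := funext fun u => (FInt_hasDerivAt u).deriv

lemma FInt_contDiff (n : ℕ) : ContDiff ℝ n FInt := by
  have : ContDiff ℝ ((n : ℕ) + 1 : ℕ) FInt := by
    push_cast
    rw [contDiff_succ_iff_deriv]
    refine ⟨fun u => (FInt_hasDerivAt u).differentiableAt, by simp, ?_⟩
    rw [FInt_deriv]; exact phiFun_contDiff n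
  exact this.of_le (by exact_mod_cast Nat.le_succ n)

lemma FInt_mono : Monotone FInt :=
  monotone_of_deriv_nonneg (fun u => (FInt_hasDerivAt u).differentiableAt)
    (fun u => by rw [FInt_deriv]; exact phiFun_nonneg u)

lemma FInt_neg_one : FInt (-1) = 0 := by simp [FInt]

lemma FInt_nonneg_of (u : ℝ) (h : u ≤ -1) : FInt u = 0 := by
  unfold FInt
  rw [intervalIntegral.integral_congr (g := fun _ => (0:ℝ))]
  · simp
  · intro x hx
    rw [Set.uIcc_of_ge h] at hx
    exact phiFun_zero (Or.inl hx.2)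

lemma FInt_eq_C (u : ℝ) (h : 1 ≤ u) : FInt u = CPhi := by
  unfold FInt CPhi
  rw [← intervalIntegral.integral_add_adjacent_intervals (b := 1)
    (phiFun_cont.intervalIntegrable _ _) (phiFun_cont.intervalIntegrable _ _)]
  rw [intervalIntegral.integral_congr (a := 1) (b := u) (g := fun _ => (0:ℝ))]
  · simp
  · intro x hx
    rw [Set.uIcc_of_le h] at hx
    exact phiFun_zero (Or.inr hx.1)

lemma FInt_pos {u : ℝ} (h : -1 < u) : 0 < FInt u := by
  have h1 : 0 < FInt (min u 1) := by
    apply intervalIntegral.intervalIntegral_pos_of_pos_on (phiFun_cont.intervalIntegrable _ _)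
    · intro x hx
      exact phiFun_pos hx.1 (lt_of_lt_of_le hx.2 (min_le_right _ _))
    · exact lt_min h (by norm_num)
  exact h1.trans_le (FInt_mono (min_le_left _ _))

lemma CPhi_pos : 0 < CPhi := by
  rw [← FInt_eq_C 1 le_rfl]; exact FInt_pos (by norm_num)

lemma PhiFun_eq (u : ℝ) : PhiFun u = FInt u / CPhi := by
  unfold PhiFun
  split_ifs with h1 h2
  · rw [FInt_nonneg_of u h1]; simp
  · rfl
  · rw [FInt_eq_C u (not_lt.1 h2), div_self CPhi_pos.ne']

lemma FInt_symm (u : ℝ) : FInt (-u) = CPhi - FInt u := by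
  have h1 : FInt (-u) = ∫ t in u..1, phiFun t := by
    unfold FInt
    have := intervalIntegral.integral_comp_neg (a := u) (b := 1) phiFun
    rw [← this]
    simp only [phiFun_neg]
  rw [h1, eq_sub_iff_add_eq, add_comm]
  exact intervalIntegral.integral_add_adjacent_intervals
    (phiFun_cont.intervalIntegrable _ _) (phiFun_cont.intervalIntegrable _ _)

lemma phiFun_hasDerivAt {t : ℝ} (h1 : -1 < t) (h2 : t < 1) :
    HasDerivAt phiFun (phiFun t * (-2 * t * ((1 + t)⁻¹ ^ 2 * (1 - t)⁻¹ ^ 2))) t := by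
  have ha : (1 + t) ≠ 0 := by linarith
  have hb : (1 - t) ≠ 0 := by linarith
  have hc : 1 - t ^ 2 ≠ 0 := by
    have : 1 - t ^ 2 = (1 + t) * (1 - t) := by ring
    rw [this]; exact mul_ne_zero ha hb
  have hd : HasDerivAt (fun x : ℝ => Real.exp (-1 / (1 - x ^ 2)))
      (phiFun t * (-2 * t * ((1 + t)⁻¹ ^ 2 * (1 - t)⁻¹ ^ 2))) t := by
    have := (((hasDerivAt_const t (-1:ℝ)).div
      ((hasDerivAt_const t (1:ℝ)).sub (hasDerivAt_pow 2 t)) hc).exp)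
    refine this.congr_deriv (Eq.symm ?_)
    unfold phiFun
    rw [if_pos ⟨h1, h2⟩]
    simp only [Pi.div_apply, Pi.sub_apply]
    congr 1
    have : 1 - t ^ 2 = (1 + t) * (1 - t) := by ring
    rw [this]
    field_simp
    push_cast
    ring
  refine hd.congr_of_eventuallyEq ?_
  filter_upwards [Ioo_mem_nhds h1 h2] with x hx
  unfold phiFun
  rw [if_pos ⟨hx.1, hx.2⟩]

lemma FInt_lower {t : ℝ} (h1 : -1 < t) (h2 : t < 0) :
    (1 + t) ^ 2 * phiFun t ≤ 6 * FInt t := by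
  have hder : ∀ x ∈ Set.Ioo (-1 : ℝ) 0, HasDerivAt
      (fun x => 6 * FInt x - (1 + x) ^ 2 * phiFun x)
      (6 * phiFun x - (2 * (1 + x) * phiFun x +
        (1 + x) ^ 2 * (phiFun x * (-2 * x * ((1 + x)⁻¹ ^ 2 * (1 - x)⁻¹ ^ 2))))) x := by
    intro x hx
    have h1 : HasDerivAt (fun x : ℝ => (1 + x) ^ 2) (2 * (1 + x)) x := by
      have := ((hasDerivAt_id x).const_add 1).pow 2
      refine this.congr_deriv (Eq.symm ?_)
      simp
    exact ((FInt_hasDerivAt x).const_mul 6).sub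
      (h1.mul (phiFun_hasDerivAt hx.1 (by linarith [hx.2])))
  have hm : MonotoneOn (fun x => 6 * FInt x - (1 + x) ^ 2 * phiFun x) (Set.Icc (-1) 0) := by
    apply monotoneOn_of_deriv_nonneg (convex_Icc _ _)
    · have := (FInt_contDiff 0).continuous
      have := phiFun_cont
      fun_prop
    · rw [interior_Icc]
      exact fun x hx => (hder x hx).differentiableAt.differentiableWithinAt
    · rw [interior_Icc]
      intro x hx
      rw [(hder x hx).deriv]
      have hx1 : (0:ℝ) < 1 + x := by linarith [hx.1]
      have hx2 : (1:ℝ) ≤ 1 - x := by linarith [hx.2]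
      have e : (1 + x) ^ 2 * (phiFun x * (-2 * x * ((1 + x)⁻¹ ^ 2 * (1 - x)⁻¹ ^ 2)))
          = phiFun x * (-2 * x * (1 - x)⁻¹ ^ 2) := by
        field_simp
      rw [e]
      have hi : (1 - x)⁻¹ ^ 2 ≤ 1 := pow_le_one₀ (by positivity) (inv_le_one_of_one_le₀ hx2)
      have hb : -2 * x * (1 - x)⁻¹ ^ 2 ≤ 2 := by
        nlinarith [hx.1, hx.2, sq_nonneg ((1 - x)⁻¹)]
      have hp := phiFun_nonneg x
      nlinarith [hx.2, mul_le_mul_of_nonneg_left hb hp, mul_nonneg hp (show 0 ≤ -x by linarith [hx.2])]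
  have := hm (Set.left_mem_Icc.2 (by norm_num)) ⟨h1.le, h2.le⟩ h1.le
  simp [FInt_neg_one] at this
  linarith

lemma FInt_upper {t : ℝ} (h1 : -1 < t) (h2 : t < 0) :
    FInt t ≤ Real.exp (-(1 / (4 * (1 + t)))) ^ 2 := by
  have ht : 0 < 1 + t := by linarith
  have := intervalIntegral.norm_integral_le_of_norm_le_const (a := -1) (b := t) (f := phiFun)
    (C := Real.exp (-(1 / (4 * (1 + t)))) ^ 2) (by
      intro x hx
      rw [Set.uIoc_of_le h1.le] at hx
      rw [Real.norm_eq_abs, abs_of_nonneg (phiFun_nonneg x)]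
      unfold phiFun
      rw [if_pos ⟨hx.1, by linarith [hx.2]⟩, ← Real.exp_nat_mul]
      apply Real.exp_le_exp.2
      have : (0:ℝ) < 1 - x ^ 2 := by nlinarith [hx.1, hx.2]
      rw [neg_div, mul_neg, neg_le_neg_iff]
      push_cast
      rw [show 2 * (1 / (4 * (1 + t))) = 1 / (2 * (1 + t)) by field_simp; norm_num]
      apply one_div_le_one_div_of_le this
      nlinarith [hx.1, hx.2, sq_nonneg (1 + x)])
  have h3 : FInt t ≤ _ := (le_abs_self _).trans this
  refine h3.trans ?_
  rw [abs_of_nonneg (by linarith)]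
  have : 0 ≤ Real.exp (-(1 / (4 * (1 + t)))) ^ 2 := by positivity
  nlinarith

/-- square root of `FInt` -/
def gFun (t : ℝ) : ℝ := Real.sqrt (FInt t)

lemma gFun_decay (k : ℕ) : ∃ C : ℝ, 0 ≤ C ∧ ∀ t : ℝ, -1 < t → t < 0 →
    gFun t ≤ C * (1 + t) ^ k := by
  refine ⟨k.factorial * 4 ^ k, by positivity, fun t h1 h2 => ?_⟩
  have ht : 0 < 1 + t := by linarith
  have hg : gFun t ≤ Real.exp (-(1 / (4 * (1 + t)))) := by
    unfold gFun
    exact Real.sqrt_le_iff.2 ⟨by positivity, FInt_upper h1 h2⟩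
  refine hg.trans ?_
  have := Real.pow_div_factorial_le_exp (x := 1 / (4 * (1 + t))) (by positivity) k
  rw [Real.exp_neg]
  rw [inv_le_comm₀ (by positivity) (by positivity)]
  refine le_trans (le_of_eq ?_) this
  rw [div_pow, mul_pow, one_pow, mul_inv, mul_inv]
  field_simp

lemma gFun_hasDerivAt {t : ℝ} (h1 : -1 < t) :
    HasDerivAt gFun (gFun t * (phiFun t / FInt t * (1 / 2))) t := by
  have hF := FInt_pos h1
  have := (FInt_hasDerivAt t).sqrt hF.ne'
  refine this.congr_deriv (Eq.symm ?_)
  have hs : Real.sqrt (FInt t) ≠ 0 := (Real.sqrt_pos.2 hF).ne'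
  unfold gFun
  have hq := Real.sq_sqrt hF.le
  field_simp
  rw [hq, mul_comm]

/-- Class of coefficient functions. -/
inductive QCls : (ℝ → ℝ) → Prop
  | const (c : ℝ) : QCls (fun _ => c)
  | id : QCls (fun t => t)
  | z : QCls (fun t => (1 + t)⁻¹)
  | q : QCls (fun t => (1 - t)⁻¹)
  | psi : QCls (fun t => phiFun t / FInt t)
  | add {f g : ℝ → ℝ} : QCls f → QCls g → QCls (fun t => f t + g t)
  | mul {f g : ℝ → ℝ} : QCls f → QCls g → QCls (fun t => f t * g t)

lemma QCls.bound {p : ℝ → ℝ} (hp : QCls p) : ∃ C : ℝ, 0 ≤ C ∧ ∃ k : ℕ, ∀ t : ℝ, -1 < t → t < 0 →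
    |p t| * (1 + t) ^ k ≤ C := by
  induction hp with
  | const c => exact ⟨|c|, abs_nonneg _, 0, fun t _ _ => by simp⟩
  | id => exact ⟨1, by norm_num, 0, fun t h1 h2 => by simp [abs_le]; constructor <;> linarith⟩
  | z =>
    refine ⟨1, by norm_num, 1, fun t h1 h2 => ?_⟩
    have : 0 < 1 + t := by linarith
    rw [abs_of_pos (by positivity), pow_one, inv_mul_cancel₀ this.ne']
  | q =>
    refine ⟨1, by norm_num, 0, fun t h1 h2 => ?_⟩
    have : 1 ≤ 1 - t := by linarith
    rw [abs_of_nonneg (by positivity), pow_zero, mul_one]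
    exact inv_le_one_of_one_le₀ this
  | psi =>
    refine ⟨6, by norm_num, 2, fun t h1 h2 => ?_⟩
    have hF := FInt_pos h1
    rw [abs_of_nonneg (div_nonneg (phiFun_nonneg t) hF.le), div_mul_eq_mul_div, div_le_iff₀ hF]
    linarith [FInt_lower h1 h2]
  | @add f g _ _ ihf ihg =>
    obtain ⟨C, hC, k, hk⟩ := ihf
    obtain ⟨D, hD, l, hl⟩ := ihg
    refine ⟨C + D, by positivity, k + l, fun t h1 h2 => ?_⟩
    have ht : 0 < 1 + t := by linarith
    have e1 : (1 + t) ^ k ≤ 1 := pow_le_one₀ ht.le (by linarith)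
    have e2 : (1 + t) ^ l ≤ 1 := pow_le_one₀ ht.le (by linarith)
    have e3 : 0 < (1 + t) ^ k := by positivity
    have e4 : 0 < (1 + t) ^ l := by positivity
    calc |f t + g t| * (1 + t) ^ (k + l)
        ≤ (|f t| + |g t|) * (1 + t) ^ (k + l) := by gcongr; exact abs_add_le _ _
      _ = (|f t| * (1 + t) ^ k) * (1 + t) ^ l + (|g t| * (1 + t) ^ l) * (1 + t) ^ k := by
        rw [pow_add]; ring
      _ ≤ C * 1 + D * 1 := by
        gcongr
        · exact hk t h1 h2
        · exact hl t h1 h2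
      _ = C + D := by ring
  | @mul f g _ _ ihf ihg =>
    obtain ⟨C, hC, k, hk⟩ := ihf
    obtain ⟨D, hD, l, hl⟩ := ihg
    refine ⟨C * D, by positivity, k + l, fun t h1 h2 => ?_⟩
    have ht : 0 < 1 + t := by linarith
    calc |f t * g t| * (1 + t) ^ (k + l)
        = (|f t| * (1 + t) ^ k) * (|g t| * (1 + t) ^ l) := by
          rw [abs_mul, pow_add]; ring
      _ ≤ C * D := mul_le_mul (hk t h1 h2) (hl t h1 h2) (by positivity) hC

lemma QCls.deriv {p : ℝ → ℝ} (hp : QCls p) : ∃ p' : ℝ → ℝ, QCls p' ∧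
    ∀ t : ℝ, -1 < t → t < 0 → HasDerivAt p (p' t) t := by
  induction hp with
  | const c => exact ⟨_, QCls.const 0, fun t _ _ => hasDerivAt_const t c⟩
  | id => exact ⟨_, QCls.const 1, fun t _ _ => hasDerivAt_id t⟩
  | z =>
    refine ⟨_, (QCls.const (-1)).mul (QCls.z.mul QCls.z), fun t h1 h2 => ?_⟩
    have h : 1 + t ≠ 0 := by linarith
    have := ((hasDerivAt_id t).const_add 1).inv h
    refine this.congr_deriv (Eq.symm ?_)
    simp only [_root_.id]
    field_simp
  | q =>
    refine ⟨_, QCls.q.mul QCls.q, fun t h1 h2 => ?_⟩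
    have h : 1 - t ≠ 0 := by linarith
    have := ((hasDerivAt_id t).const_sub 1).inv h
    refine this.congr_deriv (Eq.symm ?_)
    simp only [_root_.id]
    field_simp
  | psi =>
    refine ⟨_, (QCls.psi.mul (((QCls.const (-2)).mul QCls.id).mul
      ((QCls.z.mul QCls.z).mul (QCls.q.mul QCls.q)))).add
      ((QCls.const (-1)).mul (QCls.psi.mul QCls.psi)), fun t h1 h2 => ?_⟩
    have hF := FInt_pos h1
    have := (phiFun_hasDerivAt h1 (by linarith)).div (FInt_hasDerivAt t) hF.ne'
    refine this.congr_deriv (Eq.symm ?_)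
    have ha : 1 - t ≠ 0 := by linarith
    have hb : 1 + t ≠ 0 := by linarith
    field_simp
    ring
  | @add f g _ _ ihf ihg =>
    obtain ⟨f', hf', h1⟩ := ihf
    obtain ⟨g', hg', h2⟩ := ihg
    exact ⟨_, hf'.add hg', fun t a b => (h1 t a b).add (h2 t a b)⟩
  | @mul f g hf hg ihf ihg =>
    obtain ⟨f', hf', h1⟩ := ihf
    obtain ⟨g', hg', h2⟩ := ihg
    exact ⟨_, (hf'.mul hg).add (hf.mul hg'), fun t a b => (h1 t a b).mul (h2 t a b)⟩

lemma gFun_zero {t : ℝ} (h : t ≤ -1) : gFun t = 0 := by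
  unfold gFun; rw [FInt_nonneg_of t h, Real.sqrt_zero]

lemma gFun_nonneg (t : ℝ) : 0 ≤ gFun t := Real.sqrt_nonneg _

lemma gp_hasDerivAt {p p' : ℝ → ℝ} (hp : QCls p)
    (hd : ∀ t : ℝ, -1 < t → t < 0 → HasDerivAt p (p' t) t) {t : ℝ} (ht : t < 0) :
    HasDerivAt (fun t => gFun t * p t)
      (gFun t * (p' t + p t * (phiFun t / FInt t * (1 / 2)))) t := by
  rcases lt_trichotomy t (-1) with h | h | h
  · rw [gFun_zero h.le, zero_mul]
    refine (hasDerivAt_const t (0:ℝ)).congr_of_eventuallyEq ?_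
    filter_upwards [Iio_mem_nhds h] with x hx
    rw [gFun_zero (le_of_lt hx), zero_mul]
  · subst h
    rw [gFun_zero le_rfl, zero_mul]
    obtain ⟨C, hC, k, hk⟩ := hp.bound
    obtain ⟨D, hD, hg⟩ := gFun_decay (k + 2)
    have hO : (fun t => gFun t * p t) =O[nhds (-1 : ℝ)] fun x => ‖x - (-1)‖ ^ 2 := by
      apply Asymptotics.IsBigO.of_bound (D * C)
      filter_upwards [Iio_mem_nhds ht] with x hx
      rcases le_or_gt x (-1) with h | h
      · rw [gFun_zero h, zero_mul, norm_zero]; positivity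
      · have hs : 0 < 1 + x := by linarith
        rw [Real.norm_eq_abs, abs_mul, abs_of_nonneg (gFun_nonneg x), Real.norm_eq_abs,
          Real.norm_eq_abs, abs_pow, abs_abs, sq_abs]
        calc gFun x * |p x| ≤ (D * (1 + x) ^ (k + 2)) * |p x| := by
              gcongr; exact hg x h hx
          _ = D * (|p x| * (1 + x) ^ k) * (1 + x) ^ 2 := by rw [pow_add]; ring
          _ ≤ D * C * (1 + x) ^ 2 := by gcongr; exact hk x h hx
          _ = D * C * (x - -1) ^ 2 := by ring
    have := (hO.hasFDerivAt (𝕜 := ℝ) (by norm_num)).hasDerivAt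
    simpa using this
  · refine ((gFun_hasDerivAt h).mul (hd t h ht)).congr_deriv (Eq.symm ?_)
    ring

lemma gp_contDiffOn (n : ℕ) : ∀ {p : ℝ → ℝ}, QCls p →
    ContDiffOn ℝ n (fun t => gFun t * p t) (Set.Iio 0) := by
  induction n with
  | zero =>
    intro p hp
    obtain ⟨p', _, hd⟩ := hp.deriv
    simp only [Nat.cast_zero, contDiffOn_zero]
    exact fun t ht => (gp_hasDerivAt hp hd ht).continuousAt.continuousWithinAt
  | succ n ih =>
    intro p hp
    obtain ⟨p', hp', hd⟩ := hp.deriv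
    push_cast
    rw [contDiffOn_succ_iff_deriv_of_isOpen isOpen_Iio]
    refine ⟨fun t ht => (gp_hasDerivAt hp hd ht).differentiableAt.differentiableWithinAt,
      by simp, ?_⟩
    refine (ih (hp'.add (hp.mul (QCls.psi.mul (QCls.const (1 / 2)))))).congr ?_
    exact fun t ht => (gp_hasDerivAt hp hd ht).deriv

lemma gFun_contDiff (n : ℕ) : ContDiff ℝ n gFun := by
  rw [contDiff_iff_contDiffAt]
  intro t
  rcases lt_or_ge t 0 with h | h
  · have := (gp_contDiffOn n (QCls.const 1)).contDiffAt (Iio_mem_nhds h)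
    simpa using this
  · exact (FInt_contDiff n).contDiffAt.sqrt (FInt_pos (by linarith)).ne'

/-- The smooth profile. -/
def GFun (t : ℝ) : ℝ := Real.sqrt (PhiFun t)

lemma GFun_eq : GFun = fun t => gFun t / Real.sqrt CPhi := by
  funext t
  unfold GFun gFun
  rw [PhiFun_eq, Real.sqrt_div' _ CPhi_pos.le]

lemma GFun_contDiff (n : ℕ) : ContDiff ℝ n GFun := by
  rw [GFun_eq]; exact (gFun_contDiff n).div_const _

lemma GFun_zero {t : ℝ} (h : t ≤ -1) : GFun t = 0 := by
  unfold GFun PhiFun; rw [if_pos h, Real.sqrt_zero]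

lemma GFun_one {t : ℝ} (h : 1 ≤ t) : GFun t = 1 := by
  unfold GFun PhiFun; rw [if_neg (by linarith), if_neg (by linarith), Real.sqrt_one]

lemma PhiFun_neg (t : ℝ) : PhiFun (-t) = 1 - PhiFun t := by
  rw [PhiFun_eq, PhiFun_eq, FInt_symm, sub_div, div_self CPhi_pos.ne']

lemma GFun_bound (n : ℕ) : ∃ M : ℝ, 1 ≤ M ∧ ∀ t, |iteratedDeriv n GFun t| ≤ M := by
  obtain ⟨M, hM⟩ := (isCompact_Icc (a := (-1:ℝ)) (b := 1)).exists_bound_of_continuousOn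
    ((GFun_contDiff n).continuous_iteratedDeriv' n).continuousOn
  refine ⟨max M 1, le_max_right _ _, fun t => ?_⟩
  rcases lt_or_ge t (-1) with h | h
  · have : GFun =ᶠ[nhds t] fun _ => 0 := by
      filter_upwards [Iio_mem_nhds h] with x hx using GFun_zero (le_of_lt hx)
    rw [this.iteratedDeriv_eq n, iteratedDeriv_const]
    simp
  rcases lt_or_ge 1 t with h' | h'
  · have : GFun =ᶠ[nhds t] fun _ => 1 := by
      filter_upwards [Ioi_mem_nhds h'] with x hx using GFun_one (le_of_lt hx)
    rw [this.iteratedDeriv_eq n, iteratedDeriv_const]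
    split_ifs <;> simp
  · exact (hM t ⟨h, h'⟩).trans (le_max_left _ _)

lemma GFun_affine (n : ℕ) (c d u : ℝ) :
    iteratedDeriv n (fun x => GFun (c * x + d)) u = c ^ n * iteratedDeriv n GFun (c * u + d) := by
  have h1 : ContDiff ℝ n (fun y => GFun (y + d)) :=
    (GFun_contDiff n).comp (contDiff_id.add contDiff_const)
  have := congrFun (iteratedDeriv_comp_const_mul h1 c) u
  rw [iteratedDeriv_comp_add_const] at this
  exact this

lemma bFun_eq (S : ℕ → ℝ) (hS : StrictMono S) (j : ℕ) (hj : 1 ≤ j) :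
    bFun S j = fun u => GFun (-tauFun S j u) * GFun (tauFun S (j + 1) u) := by
  funext u
  have d1 : 0 < S j - S (j - 1) := sub_pos.2 (hS (by omega))
  have d2 : 0 < S (j + 1) - S j := sub_pos.2 (hS (by omega))
  unfold bFun aFun
  simp only [Nat.add_sub_cancel]
  have t2 : tauFun S (j + 1) u = (S (j + 1) + S j - 2 * u) / (S (j + 1) - S j) := by
    simp [tauFun]
  have t1 : -tauFun S j u = (2 * u - S j - S (j - 1)) / (S j - S (j - 1)) := by
    unfold tauFun; rw [← neg_div]; congr 1; ring
  by_cases h : u ≤ S j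
  · have hG : GFun (tauFun S (j + 1) u) = 1 := by
      apply GFun_one; rw [t2, le_div_iff₀ d2]; linarith
    rw [if_pos h, hG, mul_one]
    by_cases h0 : u ≤ S (j - 1)
    · rw [if_pos h0, GFun_zero]
      · simp
      · rw [t1, div_le_iff₀ d1]; linarith
    · rw [if_neg h0, if_pos h, GFun, PhiFun_neg]
  · have hG : GFun (-tauFun S j u) = 1 := by
      apply GFun_one; rw [t1, le_div_iff₀ d1]; linarith
    rw [if_neg h, hG, one_mul, if_neg (show ¬ u ≤ S (j - 1) by linarith), if_neg h]
    by_cases h0 : u ≤ S (j + 1)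
    · rw [if_pos h0, sub_zero, GFun]
    · rw [if_neg h0, GFun_zero]
      · simp
      · rw [t2, div_le_iff₀ d2]; linarith

/-- **Derivative bounds for the explicitly constructed windows `b_j`.**
For every `n ≥ 1` there is a constant `K(n) > 0`, independent of `j`, such that
`|b_j^{(n)}(u)| ≤ K(n)/(S_j − S_{j−1})^n` for all `j ≥ 1` and `u > 0`. -/
theorem bFun_deriv_bound
    (S : ℕ → ℝ)
    (hS0 : S 0 = 1) (hSpos : ∀ j, 0 < S j) (hSmono : StrictMono S)
    (hStop : Filter.Tendsto S Filter.atTop Filter.atTop)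
    (hSconv : ∀ j : ℕ, S (j + 1) - S j ≤ S (j + 2) - S (j + 1)) :
    ∀ n : ℕ, 1 ≤ n → ∃ K : ℝ, 0 < K ∧
      ∀ j : ℕ, 1 ≤ j → ∀ u : ℝ, 0 < u →
        |iteratedDeriv n (bFun S j) u| ≤ K / (S j - S (j - 1)) ^ n := by
  intro n _
  choose M hM1 hM using GFun_bound
  have hM0 : ∀ i, 0 < M i := fun i => lt_of_lt_of_le one_pos (hM1 i)
  refine ⟨∑ i ∈ Finset.range (n + 1), (n.choose i : ℝ) * (2 ^ n * M i * M (n - i)), ?_, ?_⟩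
  · apply Finset.sum_pos
    · intro i hi
      have : 0 < n.choose i := Nat.choose_pos (by simpa [Nat.lt_succ_iff] using hi)
      have := hM0 i
      have := hM0 (n - i)
      positivity
    · simp
  intro j hj u _
  have d1 : 0 < S j - S (j - 1) := sub_pos.2 (hSmono (by omega))
  have d2 : 0 < S (j + 1) - S j := sub_pos.2 (hSmono (by omega))
  have d12 : S j - S (j - 1) ≤ S (j + 1) - S j := by
    have := hSconv (j - 1)
    rwa [show j - 1 + 1 = j by omega, show j - 1 + 2 = j + 1 by omega] at this
  set d := S j - S (j - 1) with hd
  set d' := S (j + 1) - S j with hd'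
  have e : bFun S j = (fun u => GFun (2 / d * u + -(S j + S (j - 1)) / d)) *
      (fun u => GFun (-2 / d' * u + (S (j + 1) + S j) / d')) := by
    rw [bFun_eq S hSmono j hj]
    funext u
    simp only [Pi.mul_apply]
    congr 2
    · simp only [tauFun, ← hd]; ring
    · simp only [tauFun, Nat.add_sub_cancel, ← hd']; ring
  rw [e, iteratedDeriv_mul]
  rotate_left
  · exact ((GFun_contDiff n).comp ((contDiff_const.mul contDiff_id).add contDiff_const)).contDiffAt
  · exact ((GFun_contDiff n).comp ((contDiff_const.mul contDiff_id).add contDiff_const)).contDiffAt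
  rw [Finset.sum_div]
  refine (Finset.abs_sum_le_sum_abs _ _).trans (Finset.sum_le_sum fun i hi => ?_)
  have hin : i ≤ n := by simpa [Nat.lt_succ_iff] using hi
  rw [GFun_affine, GFun_affine]
  have a1 : |(2 / d) ^ i * iteratedDeriv i GFun (2 / d * u + -(S j + S (j - 1)) / d)|
      ≤ (2 / d) ^ i * M i := by
    rw [abs_mul, abs_of_pos (by positivity)]
    gcongr
    exact hM i _
  have a2 : |(-2 / d') ^ (n - i) *
      iteratedDeriv (n - i) GFun (-2 / d' * u + (S (j + 1) + S j) / d')|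
      ≤ (2 / d) ^ (n - i) * M (n - i) := by
    rw [abs_mul, abs_pow, abs_div, abs_neg, abs_two, abs_of_pos d2]
    gcongr
    exact hM _ _
  rw [abs_mul, abs_mul, Nat.abs_cast]
  calc _ ≤ (n.choose i : ℝ) * ((2 / d) ^ i * M i) * ((2 / d) ^ (n - i) * M (n - i)) := by
        have := hM0 i
        gcongr
    _ = (n.choose i : ℝ) * ((2 / d) ^ (i + (n - i)) * M i * M (n - i)) := by
        rw [pow_add]; ring
    _ = _ := by
        rw [Nat.add_sub_cancel' hin, div_pow]; ring
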